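/- arXiv:2104.08083 — 6 statements merged into one kernel-verified Lean document; each statement's English description precedes it below -/
import Mathlib

section
/- Let n, k, s' be positive integers with s' ≥ 2 and s'·k ≤ n. Let F be a family of k-element subsets of [n] such that for every A ∈ F there exists a positive integer p with |A ∩ [s'·p − 1]| ≥ p. Then |F| ≤ Σ_{p=1}^{k} C(s'·p − 1, p) · C(n − s'·p + 1, k − p). -/
open Finset

/-- If the initial-segment counts of a finite set `A` reach the threshold `p` at `m p`, with `m`
monotone, then at some threshold `p ≥ 1` the count is exactly `p`. -/
theorem exists_card_inter_Icc_eq {A : Finset ℕ} {m : ℕ → ℕ} (hm : Monotone m)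
    (h : ∃ p, 0 < p ∧ p ≤ (A ∩ Icc 1 (m p)).card) :
    ∃ p, 0 < p ∧ (A ∩ Icc 1 (m p)).card = p := by
  obtain ⟨p₀, hp₀, h₀⟩ := h
  have hle : ∀ p, (A ∩ Icc 1 (m p)).card ≤ A.card := fun p ↦ card_le_card inter_subset_left
  set q := Nat.findGreatest (fun p ↦ p ≤ (A ∩ Icc 1 (m p)).card) A.card
  have hp₀q : p₀ ≤ q := Nat.le_findGreatest (h₀.trans (hle p₀)) h₀
  have hspec : q ≤ (A ∩ Icc 1 (m q)).card :=
    Nat.findGreatest_spec (P := fun p ↦ p ≤ (A ∩ Icc 1 (m p)).card) (h₀.trans (hle p₀)) h₀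
  refine ⟨q, hp₀.trans_le hp₀q, le_antisymm ?_ hspec⟩
  by_contra! hlt
  have hmono : (A ∩ Icc 1 (m q)).card ≤ (A ∩ Icc 1 (m (q + 1))).card :=
    card_le_card (inter_subset_inter_left (Icc_subset_Icc_right (hm q.le_succ)))
  have hsucc : q + 1 ≤ (A ∩ Icc 1 (m (q + 1))).card := Nat.succ_le_of_lt (hlt.trans_le hmono)
  have : q + 1 ≤ q := Nat.le_findGreatest (hsucc.trans (hle _)) hsucc
  omega

/-- The number of `k`-subsets of `S` meeting `T` in exactly `p` elements is at most
`C(|T|, p) * C(|S \ T|, k - p)`. -/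
theorem card_filter_card_inter_eq_le {α : Type*} [DecidableEq α] (S T : Finset α) (k p : ℕ) :
    ((S.powersetCard k).filter fun A ↦ (A ∩ T).card = p).card ≤
      T.card.choose p * (S \ T).card.choose (k - p) := by
  rw [← card_powersetCard, ← card_powersetCard, ← card_product]
  refine card_le_card_of_injOn (fun A ↦ (A ∩ T, A \ T)) ?_ ?_
  · intro A hA
    simp only [coe_filter, mem_powersetCard, Set.mem_ofPred_eq] at hA
    obtain ⟨⟨hAS, hAk⟩, hAp⟩ := hA
    have := card_inter_add_card_sdiff A T
    simp only [coe_product, Set.mem_prod, mem_coe, mem_powersetCard]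
    exact ⟨⟨inter_subset_right, hAp⟩, sdiff_subset_sdiff hAS subset_rfl, by omega⟩
  · intro A _ B _ hAB
    simp only [Prod.mk.injEq] at hAB
    rw [← sdiff_union_inter A T, ← sdiff_union_inter B T, hAB.1, hAB.2]

/-- Counting bound: if every `A` in a family `F` of `k`-subsets of `[n]` satisfies
`|A ∩ [s'p − 1]| ≥ p` for some positive integer `p`, then
`|F| ≤ Σ_{p=1}^{k} C(s'p − 1, p) C(n − s'p + 1, k − p)`. -/
theorem counting_bound (n k s' : ℕ) (hs' : 2 ≤ s') (hk : 0 < k) (hn : s' * k ≤ n)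
    (F : Finset (Finset ℕ)) (hF : F ⊆ (Finset.Icc 1 n).powersetCard k)
    (hcond : ∀ A ∈ F, ∃ p : ℕ, 0 < p ∧ p ≤ (A ∩ Finset.Icc 1 (s' * p - 1)).card) :
    F.card ≤ ∑ p ∈ Finset.Icc 1 k,
      (s' * p - 1).choose p * (n - s' * p + 1).choose (k - p) := by
  have hsub : F ⊆ (Icc 1 k).biUnion fun p ↦
      ((Icc 1 n).powersetCard k).filter fun A ↦ (A ∩ Icc 1 (s' * p - 1)).card = p := by
    intro A hA
    have hmono : Monotone fun p ↦ s' * p - 1 := fun a b hab ↦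
      Nat.sub_le_sub_right (Nat.mul_le_mul_left s' hab) 1
    obtain ⟨p, hp, hAp⟩ := exists_card_inter_Icc_eq hmono (hcond A hA)
    have hpk : p ≤ k := by
      rw [← (mem_powersetCard.mp (hF hA)).2, ← hAp]
      exact card_le_card inter_subset_left
    exact mem_biUnion.mpr ⟨p, mem_Icc.mpr ⟨hp, hpk⟩, mem_filter.mpr ⟨hF hA, hAp⟩⟩
  refine (card_le_card hsub).trans (card_biUnion_le.trans (sum_le_sum fun p hp ↦ ?_))
  obtain ⟨hp, hpk⟩ := mem_Icc.mp hp
  have hpn : s' * p ≤ n := (Nat.mul_le_mul_left s' hpk).trans hn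
  have hpos : 0 < s' * p := Nat.mul_pos (by omega) hp
  have hdiff : (Icc 1 n \ Icc 1 (s' * p - 1)).card = n - s' * p + 1 := by
    rw [card_sdiff_of_subset (Icc_subset_Icc_right (by omega)), Nat.card_Icc, Nat.card_Icc]
    omega
  simpa only [Nat.card_Icc, Nat.add_sub_cancel, hdiff] using
    card_filter_card_inter_eq_le (Icc 1 n) (Icc 1 (s' * p - 1)) k p
end

section
/- Let n, k, s', p be positive integers with s' ≥ 2, 2 ≤ p ≤ k, and n > k·s'. Then C(s'·p − 1, p)·C(n − s'·p + 1, k − p) ≤ (e·k·s'/n) · C(s'·(p−1) − 1, p−1)·C(n − s'·(p−1) + 1, k − p + 1), where e is Euler's number. -/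
open Finset

theorem choose_mul_sub_one_mul (t r : ℕ) (hr : 1 ≤ r) :
    ((t + 1) * r - 1).choose r * (t + 1) = ((t + 1) * r).choose r * t := by
  have h := Nat.choose_mul_succ_eq ((t + 1) * r - 1) r
  have hpos : 1 ≤ (t + 1) * r := Nat.mul_pos t.succ_pos hr
  have hsub : (t + 1) * r - r = t * r := by rw [Nat.add_one_mul]; omega
  rw [Nat.sub_add_cancel hpos, hsub] at h
  apply Nat.eq_of_mul_eq_mul_right hr
  linarith

theorem pow_mul_factorial_add_le (t q j : ℕ) :
    t ^ j * ((t + 1) * q + j).factorial * (t * q).factorial ≤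
      (t + 1) ^ j * ((t + 1) * q).factorial * (t * q + j).factorial := by
  induction j with
  | zero => simp
  | succ j ih =>
    rw [← add_assoc, ← add_assoc, Nat.factorial_succ, Nat.factorial_succ, pow_succ, pow_succ]
    have h : t * ((t + 1) * q + j + 1) ≤ (t + 1) * (t * q + j + 1) := by nlinarith
    calc _ = (t * ((t + 1) * q + j + 1)) *
          (t ^ j * ((t + 1) * q + j).factorial * (t * q).factorial) := by ring
      _ ≤ _ := Nat.mul_le_mul h ih
      _ = _ := by ring

theorem choose_mul_succ_mul_pow_le (t q : ℕ) :
    ((t + 1) * (q + 1)).choose (q + 1) * t ^ t ≤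
      (t + 1) ^ (t + 1) * ((t + 1) * q).choose q := by
  have key (r : ℕ) : ((t + 1) * r).choose r * r.factorial * (t * r).factorial =
      ((t + 1) * r).factorial := by
    have h := Nat.choose_mul_factorial_mul_factorial (Nat.le_mul_of_pos_left r t.succ_pos)
    rwa [show (t + 1) * r - r = t * r by rw [Nat.add_one_mul]; omega] at h
  have h0 := key q
  have h1 := key (q + 1)
  have h2 := pow_mul_factorial_add_le t q t
  have h3 : ((t + 1) * (q + 1)).factorial =
      (t + 1) * (q + 1) * ((t + 1) * q + t).factorial := by
    rw [show (t + 1) * (q + 1) = (t + 1) * q + t + 1 by ring, Nat.factorial_succ]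
  rw [h3] at h1
  rw [show t * (q + 1) = t * q + t by ring] at h1
  have hpos : 0 < (q + 1).factorial * (t * q + t).factorial * (t * q).factorial := by positivity
  refine Nat.le_of_mul_le_mul_right ?_ hpos
  calc _ = (((t + 1) * (q + 1)).choose (q + 1) * (q + 1).factorial * (t * q + t).factorial) *
        t ^ t * (t * q).factorial := by ring
    _ = (t + 1) * (q + 1) *
        (t ^ t * ((t + 1) * q + t).factorial * (t * q).factorial) := by rw [h1]; ring
    _ ≤ (t + 1) * (q + 1) *
        ((t + 1) ^ t * ((t + 1) * q).factorial * (t * q + t).factorial) := by gcongr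
    _ = _ := by rw [← h0, Nat.factorial_succ q]; ring

theorem succ_pow_le_exp_one_mul_pow (t : ℕ) (ht : 1 ≤ t) :
    ((t : ℝ) + 1) ^ t ≤ Real.exp 1 * (t : ℝ) ^ t := by
  have ht' : (0 : ℝ) < t := by exact_mod_cast ht
  have h : 1 + 1 / (t : ℝ) ≤ Real.exp (1 / t) := by
    linarith [Real.add_one_le_exp (1 / (t : ℝ))]
  calc ((t : ℝ) + 1) ^ t = (1 + 1 / (t : ℝ)) ^ t * (t : ℝ) ^ t := by
        rw [← mul_pow]; congr 1; field_simp
    _ ≤ Real.exp (1 / t) ^ t * (t : ℝ) ^ t := by gcongr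
    _ = _ := by rw [← Real.exp_nat_mul, mul_one_div_cancel ht'.ne']

theorem choose_mul_sub_one_le (t q : ℕ) (ht : 1 ≤ t) (hq : 1 ≤ q) :
    (((t + 1) * (q + 1) - 1).choose (q + 1) : ℝ) ≤
      Real.exp 1 * (t + 1) * (((t + 1) * q - 1).choose q : ℝ) := by
  have ht' : (0 : ℝ) < t := by exact_mod_cast ht
  have h1 := choose_mul_sub_one_mul t (q + 1) (by omega)
  have h2 := choose_mul_sub_one_mul t q hq
  have h : ((t + 1) * (q + 1) - 1).choose (q + 1) * t ^ t ≤
      (t + 1) ^ (t + 1) * ((t + 1) * q - 1).choose q := by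
    refine Nat.le_of_mul_le_mul_right ?_ (Nat.add_one_pos t)
    calc _ = ((t + 1) * (q + 1)).choose (q + 1) * t ^ t * t := by
          linear_combination t ^ t * h1
      _ ≤ (t + 1) ^ (t + 1) * ((t + 1) * q).choose q * t :=
          Nat.mul_le_mul_right _ (choose_mul_succ_mul_pow_le t q)
      _ = _ := by rw [mul_assoc, ← h2]; ring
  have h' : (((t + 1) * (q + 1) - 1).choose (q + 1) : ℝ) * (t : ℝ) ^ t ≤
      ((t : ℝ) + 1) ^ (t + 1) * (((t + 1) * q - 1).choose q : ℝ) := by exact_mod_cast h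
  refine le_of_mul_le_mul_right (h'.trans ?_) (pow_pos ht' t)
  calc _ = ((t : ℝ) + 1) ^ t * ((t + 1) * (((t + 1) * q - 1).choose q : ℝ)) := by ring
    _ ≤ Real.exp 1 * (t : ℝ) ^ t * ((t + 1) * (((t + 1) * q - 1).choose q : ℝ)) := by
        gcongr; exact succ_pow_le_exp_one_mul_pow t ht
    _ = _ := by ring

theorem mul_choose_sub_le (n k s q : ℕ) (hs : 1 ≤ s) (hq : 1 ≤ q) (hqk : q + 1 ≤ k)
    (hn : k * s < n) :
    n * (n - s * (q + 1) + 1).choose (k - (q + 1)) ≤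
      k * (n - s * q + 1).choose (k - (q + 1) + 1) := by
  obtain ⟨m, rfl⟩ := Nat.exists_eq_add_of_le hqk
  have hle : s * (q + 1) ≤ (q + 1 + m) * s := by nlinarith
  obtain ⟨M, rfl⟩ := Nat.exists_eq_add_of_le (hle.trans hn.le)
  rw [Nat.add_sub_cancel_left, Nat.add_sub_cancel_left,
    show s * (q + 1) + M - s * q = M + s by rw [mul_add]; omega]
  have hmono : (M + 1).choose m ≤ (M + s).choose m := Nat.choose_le_choose m (by omega)
  have habs := Nat.add_one_mul_choose_eq (M + s) m
  have hcoef : (m + 1) * (s * (q + 1) + M) ≤ (q + 1 + m) * (M + s + 1) := by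
    have hM : m * s ≤ M := by nlinarith
    nlinarith [Nat.mul_le_mul_right q hM]
  refine Nat.le_of_mul_le_mul_right ?_ (Nat.add_one_pos m)
  calc _ = (m + 1) * (s * (q + 1) + M) * (M + 1).choose m := by ring
    _ ≤ (q + 1 + m) * (M + s + 1) * (M + s).choose m := Nat.mul_le_mul hcoef hmono
    _ = _ := by rw [mul_assoc, habs]; ring

/-- Ratio bound for consecutive terms: for `2 ≤ p ≤ k` and `n > ks'`,
`C(s'p − 1, p) C(n − s'p + 1, k − p) ≤ (eks'/n) C(s'(p−1) − 1, p−1) C(n − s'(p−1) + 1, k − p + 1)`. -/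
theorem ratio_bound (n k s' p : ℕ) (hs' : 2 ≤ s') (hp : 2 ≤ p) (hpk : p ≤ k)
    (hn : k * s' < n) :
    ((s' * p - 1).choose p * (n - s' * p + 1).choose (k - p) : ℝ) ≤
      (Real.exp 1 * k * s' / n) *
        ((s' * (p - 1) - 1).choose (p - 1) *
          (n - s' * (p - 1) + 1).choose (k - p + 1) : ℝ) := by
  obtain ⟨t, rfl⟩ : ∃ t, s' = t + 1 := ⟨s' - 1, by omega⟩
  obtain ⟨q, rfl⟩ : ∃ q, p = q + 1 := ⟨p - 1, by omega⟩
  rw [Nat.add_sub_cancel]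
  have h1 := choose_mul_sub_one_le t q (by omega) (by omega)
  have h2 : (n : ℝ) * ((n - (t + 1) * (q + 1) + 1).choose (k - (q + 1)) : ℝ) ≤
      k * ((n - (t + 1) * q + 1).choose (k - (q + 1) + 1) : ℝ) := by
    exact_mod_cast mul_choose_sub_le n k (t + 1) q (by omega) (by omega) hpk hn
  have hn0 : (0 : ℝ) < n := by exact_mod_cast (Nat.zero_le _).trans_lt hn
  rw [div_mul_eq_mul_div, le_div_iff₀ hn0]
  push_cast
  have h := mul_le_mul h1 h2 (by positivity) (by positivity)
  linarith
end

section
/- Let n, k, s' be positive integers with s' ≥ 2 and n ≥ 4·e·k·s' (where e is Euler's number). Then Σ_{p=1}^{k} C(s'·p − 1, p)·C(n − s'·p + 1, k − p) ≤ (4/3)·(s' − 1)·C(n − s' + 1, k − 1). -/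
open Finset

/-- A form of `(p ^ p) / p! ≤ e ^ (p - 1)`, with `p = q + 1`. -/
theorem succ_pow_succ_le_exp_pow_mul_factorial (q : ℕ) :
    ((q : ℝ) + 1) ^ (q + 1) ≤ Real.exp 1 ^ q * (q + 1).factorial := by
  induction q with
  | zero => simp
  | succ q ih =>
    have hq : (0 : ℝ) < (q : ℝ) + 1 := by positivity
    have hratio : ((q : ℝ) + 1 + 1) ^ (q + 1) ≤ Real.exp 1 * ((q : ℝ) + 1) ^ (q + 1) := by
      have hexp : 1 / ((q : ℝ) + 1) + 1 ≤ Real.exp (1 / ((q : ℝ) + 1)) := Real.add_one_le_exp _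
      have hpow := pow_le_pow_left₀ (by positivity) hexp (q + 1)
      rw [← Real.exp_nat_mul] at hpow
      have hone : ((q + 1 : ℕ) : ℝ) * (1 / ((q : ℝ) + 1)) = 1 := by
        push_cast
        field_simp
      rw [hone] at hpow
      calc ((q : ℝ) + 1 + 1) ^ (q + 1)
          = (1 / ((q : ℝ) + 1) + 1) ^ (q + 1) * ((q : ℝ) + 1) ^ (q + 1) := by
            rw [← mul_pow]
            congr 1
            field_simp
            ring
        _ ≤ _ := by gcongr
    rw [Nat.factorial_succ (q + 1), pow_succ, pow_succ (Real.exp 1)]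
    push_cast
    calc ((q : ℝ) + 1 + 1) ^ (q + 1) * ((q : ℝ) + 1 + 1)
        ≤ Real.exp 1 * (Real.exp 1 ^ q * (q + 1).factorial) * ((q : ℝ) + 1 + 1) := by
          gcongr
          exact hratio.trans (by gcongr)
      _ = _ := by ring

theorem choose_mul_succ_sub_one_le (s q : ℕ) (hs : 1 ≤ s) :
    ((s * (q + 1) - 1).choose (q + 1) : ℝ) ≤ ((s : ℝ) - 1) * (Real.exp 1 * s) ^ q := by
  obtain ⟨t, rfl⟩ := Nat.exists_eq_add_of_le' hs
  have hsub : (t + 1) * (q + 1) - 1 - q = t * (q + 1) := by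
    rw [add_one_mul]
    omega
  have hdesc : (q + 1).factorial * ((t + 1) * (q + 1) - 1).choose (q + 1)
      ≤ t * (q + 1) * ((t + 1) * (q + 1)) ^ q := by
    rw [← Nat.descFactorial_eq_factorial_mul_choose, Nat.descFactorial_succ, hsub]
    gcongr
    exact (Nat.descFactorial_le_pow _ _).trans (Nat.pow_le_pow_left (Nat.sub_le _ _) _)
  have hdesc' : ((q + 1).factorial : ℝ) * (((t + 1) * (q + 1) - 1).choose (q + 1) : ℕ)
      ≤ t * (q + 1) * ((t + 1) * (q + 1)) ^ q := by exact_mod_cast hdesc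
  have hfac : (0 : ℝ) < (q + 1).factorial := by positivity
  refine le_of_mul_le_mul_left (hdesc'.trans ?_) hfac
  push_cast
  calc (t : ℝ) * (q + 1) * ((t + 1) * (q + 1)) ^ q
      = t * (t + 1) ^ q * ((q : ℝ) + 1) ^ (q + 1) := by
        rw [mul_pow]
        ring
    _ ≤ t * (t + 1) ^ q * (Real.exp 1 ^ q * (q + 1).factorial) := by
        gcongr
        exact succ_pow_succ_le_exp_pow_mul_factorial q
    _ = _ := by
        rw [mul_pow]
        ring

/-- Lowering both entries of a binomial coefficient `C(N, K)` with `c * K ≤ N` costs a factor of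
at least `c`. -/
theorem choose_sub_pred_mul_le {N K s : ℕ} {c : ℝ} (hs : 1 ≤ s) (hK : 1 ≤ K) (hN : 1 ≤ N)
    (hc : c * K ≤ N) : ((N - s).choose (K - 1) : ℝ) * c ≤ N.choose K := by
  obtain ⟨M, rfl⟩ := Nat.exists_eq_add_of_le' hN
  obtain ⟨L, rfl⟩ := Nat.exists_eq_add_of_le' hK
  have hmono : ((M + 1 - s).choose L : ℝ) ≤ M.choose L := by
    exact_mod_cast Nat.choose_le_choose L (by omega)
  have hmul : ((M + 1 : ℕ) : ℝ) * M.choose L = (M + 1).choose (L + 1) * (L + 1 : ℕ) := by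
    exact_mod_cast Nat.add_one_mul_choose_eq M L
  have hL : (0 : ℝ) < (L + 1 : ℕ) := by positivity
  refine le_of_mul_le_mul_right ?_ hL
  rw [← hmul, Nat.add_sub_cancel, mul_assoc, mul_comm]
  exact mul_le_mul hc hmono (by positivity) (by positivity)

theorem choose_sub_mul_succ_mul_pow_le {n k s : ℕ} {c : ℝ} (hs : 1 ≤ s) (hsc : s ≤ c)
    (hn : c * k ≤ n) (q : ℕ) (hq : q < k) :
    ((n - s * (q + 1) + 1).choose (k - (q + 1)) : ℝ) * c ^ q ≤
      (n - s + 1).choose (k - 1) := by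
  have hc : (0 : ℝ) ≤ c := (Nat.cast_nonneg s).trans hsc
  induction q with
  | zero => simp
  | succ q ih =>
    have hskn : s * k ≤ n := by
      have : (s : ℝ) * k ≤ n := (by gcongr : (s : ℝ) * k ≤ c * k).trans hn
      exact_mod_cast this
    have hle : s * (q + 1 + 1) ≤ n := (Nat.mul_le_mul_left s (by omega)).trans hskn
    have hadd : s * (q + 1 + 1) = s * (q + 1) + s := by ring
    have hN : n - s * (q + 1 + 1) + 1 = n - s * (q + 1) + 1 - s := by omega
    have hstep : c * (k - (q + 1) : ℕ) ≤ (n - s * (q + 1) + 1 : ℕ) := by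
      rw [Nat.cast_sub (by omega), Nat.cast_add (n - _), Nat.cast_sub (by omega)]
      push_cast
      have : (s : ℝ) * (q + 1) ≤ c * (q + 1) := by gcongr
      linarith
    have hdrop := choose_sub_pred_mul_le hs (by omega) (by omega) hstep
    rw [hN, ← Nat.sub_sub k (q + 1) 1, pow_succ']
    calc _ = ((n - s * (q + 1) + 1 - s).choose (k - (q + 1) - 1) : ℝ) * c * c ^ q := by ring
      _ ≤ (n - s * (q + 1) + 1).choose (k - (q + 1)) * c ^ q := by gcongr
      _ ≤ _ := ih (by omega)

/-- Geometric-series bound: for `n ≥ 4eks'`,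
`Σ_{p=1}^{k} C(s'p − 1, p) C(n − s'p + 1, k − p) ≤ (4/3)(s' − 1) C(n − s' + 1, k − 1)`. -/
theorem sum_bound (n k s' : ℕ) (hk : 0 < k) (hs' : 2 ≤ s')
    (hn : (4 : ℝ) * Real.exp 1 * k * s' ≤ n) :
    ((∑ p ∈ Finset.Icc 1 k,
        (s' * p - 1).choose p * (n - s' * p + 1).choose (k - p) : ℕ) : ℝ) ≤
      (4 / 3) * ((s' : ℝ) - 1) * ((n - s' + 1).choose (k - 1) : ℝ) := by
  have hs : (0 : ℝ) ≤ (s' : ℝ) - 1 := by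
    have : (2 : ℝ) ≤ s' := by exact_mod_cast hs'
    linarith
  have hsc : (s' : ℝ) ≤ 4 * (Real.exp 1 * s') := by
    have := Real.add_one_le_exp (1 : ℝ)
    nlinarith
  have hterm : ∀ q ∈ range k,
      ((s' * (q + 1) - 1).choose (q + 1) : ℝ) * (n - s' * (q + 1) + 1).choose (k - (q + 1)) ≤
        ((s' : ℝ) - 1) * (n - s' + 1).choose (k - 1) * (1 / 4) ^ q := by
    intro q hq
    have hdecay := choose_sub_mul_succ_mul_pow_le (by omega) hsc (by linarith) q (mem_range.mp hq)
    calc _ ≤ ((s' : ℝ) - 1) * (Real.exp 1 * s') ^ q *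
          (n - s' * (q + 1) + 1).choose (k - (q + 1)) := by
          gcongr
          exact choose_mul_succ_sub_one_le s' q (by omega)
      _ = ((s' : ℝ) - 1) * (((n - s' * (q + 1) + 1).choose (k - (q + 1)) : ℝ) *
          (4 * (Real.exp 1 * s')) ^ q) * (1 / 4) ^ q := by
          rw [mul_pow 4, one_div, inv_pow]
          field_simp
      _ ≤ _ := by gcongr
  have hgeom : ∑ q ∈ range k, (1 / 4 : ℝ) ^ q ≤ 4 / 3 := by
    have : (0 : ℝ) ≤ (1 / 4) ^ k := by positivity
    have := geom_sum_mul (1 / 4 : ℝ) k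
    linarith
  rw [← Finset.Ico_add_one_right_eq_Icc, Finset.sum_Ico_eq_sum_range]
  simp only [Nat.add_sub_cancel, add_comm 1]
  push_cast
  refine (sum_le_sum hterm).trans ?_
  rw [← mul_sum]
  calc _ ≤ ((s' : ℝ) - 1) * (n - s' + 1).choose (k - 1) * (4 / 3) := by gcongr
    _ = _ := by ring
end

section
/- Let n, k, s' be positive integers with s' ≥ 2 and k·s' ≤ n, and let F be a shifted family of k-element subsets of [n]. Suppose A ∈ F satisfies |A ∩ [s'·p − 1]| ≤ p − 1 for every p ∈ [k]. Then the set G = {s', 2s', …, k·s'} belongs to F. -/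
open Finset

/-- A family of subsets of `[n]` is shifted if replacing a larger element by a smaller
missing one keeps sets in the family. -/
def Shifted (n : ℕ) (F : Finset (Finset ℕ)) : Prop :=
  ∀ i j : ℕ, 1 ≤ i → i < j → j ≤ n → ∀ A ∈ F, j ∈ A → i ∉ A → insert i (A.erase j) ∈ F

/-- A shifted family containing `A` contains every set `G` of the same size that precedes `A`
componentwise, i.e. such that every initial segment meets `G` in at least as many elements as
`A`. -/
theorem Shifted.mem_of_card_filter_le {n : ℕ} {F : Finset (Finset ℕ)} (hshift : Shifted n F)
    {G : Finset ℕ} (hG : ∀ x ∈ G, 1 ≤ x) {A : Finset ℕ} (hA : A ∈ F) (hAn : ∀ x ∈ A, x ≤ n)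
    (hcard : A.card = G.card)
    (hle : ∀ m, (A.filter (· ≤ m)).card ≤ (G.filter (· ≤ m)).card) : G ∈ F := by
  induction hd : (A \ G).card generalizing A with
  | zero =>
    rw [Finset.card_eq_zero, Finset.sdiff_eq_empty_iff_subset] at hd
    rwa [← Finset.eq_of_subset_of_card_le hd hcard.ge]
  | succ d ih =>
    have hne : (A \ G).Nonempty := Finset.card_pos.mp (by omega)
    obtain ⟨j, hj, hmin⟩ := (A \ G).exists_min_image id hne
    have hjA : j ∈ A := (Finset.mem_sdiff.mp hj).1
    have hjG : j ∉ G := (Finset.mem_sdiff.mp hj).2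
    have hlt : ∀ x ∈ A, x < j → x ∈ G := fun x hx hxj => by
      by_contra hxG
      exact absurd (hmin x (Finset.mem_sdiff.mpr ⟨hx, hxG⟩)) (not_le.mpr hxj)
    obtain ⟨i, hiG, hiA, hij⟩ : ∃ i ∈ G, i ∉ A ∧ i < j := by
      by_contra! hcon
      have hss : G.filter (· ≤ j) ⊂ A.filter (· ≤ j) := by
        rw [Finset.ssubset_iff_of_subset]
        · exact ⟨j, by simp [hjA], by simp [hjG]⟩
        · intro x hx
          rw [Finset.mem_filter] at hx ⊢
          refine ⟨?_, hx.2⟩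
          by_contra hxA
          have hjx := hcon x hx.1 hxA
          exact hjG (le_antisymm hx.2 hjx ▸ hx.1)
      exact absurd (hle j) (not_le.mpr (Finset.card_lt_card hss))
    have hiE : i ∉ A.erase j := fun h => hiA (Finset.mem_of_mem_erase h)
    refine ih (hshift i j (hG i hiG) hij (hAn j hjA) A hA hjA hiA) ?_ ?_ ?_ ?_
    · intro x hx
      rcases Finset.mem_insert.mp hx with rfl | hx
      · exact hij.le.trans (hAn j hjA)
      · exact hAn x (Finset.mem_of_mem_erase hx)
    · rw [Finset.card_insert_of_notMem hiE, Finset.card_erase_add_one hjA, hcard]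
    · intro m
      rcases lt_or_ge m j with hm | hm
      · refine Finset.card_le_card fun x hx => ?_
        rw [Finset.mem_filter] at hx ⊢
        refine ⟨?_, hx.2⟩
        rcases Finset.mem_insert.mp hx.1 with rfl | hxE
        · exact hiG
        · exact hlt x (Finset.mem_of_mem_erase hxE) (hx.2.trans_lt hm)
      · refine le_trans (le_of_eq ?_) (hle m)
        rw [Finset.filter_insert, if_pos (hij.le.trans hm), Finset.filter_erase,
          Finset.card_insert_of_notMem (by simp [hiA]),
          Finset.card_erase_add_one (by simp [hjA, hm])]
    · rw [Finset.insert_sdiff_of_mem _ hiG, Finset.erase_sdiff_comm,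
        Finset.card_erase_of_mem hj, hd, Nat.add_sub_cancel]

/-- Shiftedness argument: if a shifted family `F` of `k`-subsets of `[n]` contains a set
`A` with `|A ∩ [s'p − 1]| ≤ p − 1` for every `p ∈ [k]`, then the set
`G = {s', 2s', …, ks'}` belongs to `F`. -/
theorem shifted_contains_arithmetic (n k s' : ℕ) (hk : 0 < k) (hs' : 2 ≤ s')
    (hn : k * s' ≤ n)
    (F : Finset (Finset ℕ)) (hF : F ⊆ (Finset.Icc 1 n).powersetCard k)
    (hshift : Shifted n F)
    (A : Finset ℕ) (hA : A ∈ F)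
    (hcond : ∀ p ∈ Finset.Icc 1 k, (A ∩ Finset.Icc 1 (s' * p - 1)).card ≤ p - 1) :
    (Finset.Icc 1 k).image (fun p => s' * p) ∈ F := by
  obtain ⟨hAsub, hAcard⟩ := Finset.mem_powersetCard.mp (hF hA)
  have hs : 0 < s' := by omega
  have hinj : Function.Injective (fun p => s' * p) := fun a b h => Nat.eq_of_mul_eq_mul_left hs h
  have hGcard : ((Finset.Icc 1 k).image (fun p => s' * p)).card = k := by
    rw [Finset.card_image_of_injective _ hinj, Nat.card_Icc, Nat.add_sub_cancel]
  refine hshift.mem_of_card_filter_le ?_ hA (fun x hx => (Finset.mem_Icc.mp (hAsub hx)).2)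
    (hAcard.trans hGcard.symm) fun m => ?_
  · intro x hx
    obtain ⟨p, hp, rfl⟩ := Finset.mem_image.mp hx
    exact Nat.mul_pos hs (Finset.mem_Icc.mp hp).1
  · have hsub : (Finset.Icc 1 (min k (m / s'))).image (fun p => s' * p) ⊆
        ((Finset.Icc 1 k).image (fun p => s' * p)).filter (· ≤ m) := by
      intro x hx
      obtain ⟨p, hp, rfl⟩ := Finset.mem_image.mp hx
      rw [Finset.mem_Icc, le_min_iff] at hp
      refine Finset.mem_filter.mpr
        ⟨Finset.mem_image_of_mem _ (Finset.mem_Icc.mpr ⟨hp.1, hp.2.1⟩), ?_⟩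
      exact (Nat.mul_le_mul_left s' hp.2.2).trans (Nat.mul_div_le m s')
    refine le_trans ?_ (Finset.card_le_card hsub)
    rw [Finset.card_image_of_injective _ hinj, Nat.card_Icc, Nat.add_sub_cancel, le_min_iff]
    refine ⟨hAcard ▸ Finset.card_filter_le _ _, ?_⟩
    rcases lt_or_ge (m / s') k with hq | hq
    · refine le_trans (Finset.card_le_card fun x hx => ?_)
        (hcond (m / s' + 1) (Finset.mem_Icc.mpr ⟨Nat.le_add_left 1 _, hq⟩))
      rw [Finset.mem_filter] at hx
      have hm := Nat.lt_mul_div_succ m hs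
      exact Finset.mem_inter.mpr ⟨hx.1, Finset.mem_Icc.mpr
        ⟨(Finset.mem_Icc.mp (hAsub hx.1)).1, hx.2.trans (Nat.le_sub_one_of_lt hm)⟩⟩
    · exact (hAcard ▸ Finset.card_filter_le _ _ : _ ≤ k).trans hq
end

section
/- Let n, k, s be positive integers with s + 1 ≤ n and k ≥ 1, and let F be a shifted family of k-element subsets of [n]. Then ∂(F(∅)) ⊆ F({s+1}) and F({j+1}) ⊆ F({j}) for every j ∈ [s]; that is, ∂(F(∅)) ⊆ F({s+1}) ⊆ F({s}) ⊆ … ⊆ F({1}). -/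
open Finset

/-- The link `F({j}) = {A \ {j} : A ∈ F, A ∩ [s+1] = {j}}`. -/
def link (s : ℕ) (F : Finset (Finset ℕ)) (j : ℕ) : Finset (Finset ℕ) :=
  (F.filter fun A => A ∩ Finset.Icc 1 (s + 1) = {j}).image fun A => A.erase j

/-- `F(∅) = {A ∈ F : A ∩ [s+1] = ∅}`. -/
def emptyPart (s : ℕ) (F : Finset (Finset ℕ)) : Finset (Finset ℕ) :=
  F.filter fun A => A ∩ Finset.Icc 1 (s + 1) = ∅

/-- The shadow of a family of `k`-sets: all `(k−1)`-sets contained in some member. -/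
def shadow' (k : ℕ) (G : Finset (Finset ℕ)) : Finset (Finset ℕ) :=
  G.biUnion fun A => A.powersetCard (k - 1)

/-- For a shifted family `F` of `k`-subsets of `[n]` one has the chain
`∂(F(∅)) ⊆ F({s+1}) ⊆ F({s}) ⊆ … ⊆ F({1})`. -/
theorem shifted_link_chain (n k s : ℕ) (hs : 0 < s) (hk : 1 ≤ k) (hn : s + 1 ≤ n)
    (F : Finset (Finset ℕ)) (hF : F ⊆ (Finset.Icc 1 n).powersetCard k)
    (hshift : Shifted n F) :
    shadow' k (emptyPart s F) ⊆ link s F (s + 1) ∧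
    ∀ j ∈ Finset.Icc 1 s, link s F (j + 1) ⊆ link s F j := by
  have mem_Icc_of_mem : ∀ A ∈ F, ∀ x ∈ A, 1 ≤ x ∧ x ≤ n := fun A hA x hx =>
    Finset.mem_Icc.1 ((Finset.mem_powersetCard.1 (hF hA)).1 hx)
  constructor
  · intro B hB
    simp only [shadow', emptyPart, Finset.mem_biUnion, Finset.mem_filter,
      Finset.mem_powersetCard] at hB
    obtain ⟨A, ⟨hA, hdisj⟩, hBA, hBcard⟩ := hB
    have hAcard := (Finset.mem_powersetCard.1 (hF hA)).2
    have hlarge : ∀ x ∈ A, s + 1 < x := by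
      intro x hx
      by_contra! hle
      have hmem : x ∈ A ∩ Finset.Icc 1 (s + 1) :=
        Finset.mem_inter.2 ⟨hx, Finset.mem_Icc.2 ⟨(mem_Icc_of_mem A hA x hx).1, hle⟩⟩
      simp [hdisj] at hmem
    obtain ⟨a, haB, rfl⟩ := (Finset.covBy_iff_exists_insert (s := B) (t := A)).1
      (Finset.covBy_iff_card_sdiff_eq_one.2 ⟨hBA, by
        rw [Finset.card_sdiff_of_subset hBA]; omega⟩)
    have ha := Finset.mem_insert_self a B
    have hs1 : s + 1 ∉ insert a B := fun h => (hlarge _ h).false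
    have hshifted := hshift (s + 1) a (by omega) (hlarge a ha) (mem_Icc_of_mem _ hA a ha).2
      _ hA ha hs1
    rw [Finset.erase_insert haB] at hshifted
    refine Finset.mem_image.2 ⟨insert (s + 1) B, Finset.mem_filter.2 ⟨hshifted, ?_⟩,
      Finset.erase_insert fun h => hs1 (Finset.mem_insert_of_mem h)⟩
    ext x
    have hx : x ∈ B → s + 1 < x := fun h => hlarge x (Finset.mem_insert_of_mem h)
    simp only [Finset.mem_inter, Finset.mem_insert, Finset.mem_Icc, Finset.mem_singleton]
    grind
  · intro j hj B hB
    rw [Finset.mem_Icc] at hj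
    simp only [link, Finset.mem_image, Finset.mem_filter] at hB ⊢
    obtain ⟨A, ⟨hA, htrace⟩, rfl⟩ := hB
    have htrace_iff : ∀ x, (x ∈ A ∧ 1 ≤ x ∧ x ≤ s + 1) ↔ x = j + 1 := fun x => by
      simpa using Finset.ext_iff.1 htrace x
    have hjA : j + 1 ∈ A := ((htrace_iff _).2 rfl).1
    have hjA' : j ∉ A := fun h => by
      have := (htrace_iff j).1 ⟨h, by omega, by omega⟩
      omega
    refine ⟨insert j (A.erase (j + 1)),
      ⟨hshift j (j + 1) hj.1 (by omega) (by omega) A hA hjA hjA', ?_⟩,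
      Finset.erase_insert fun h => hjA' (Finset.mem_of_mem_erase h)⟩
    ext x
    have hx := htrace_iff x
    simp only [Finset.mem_inter, Finset.mem_insert, Finset.mem_erase, Finset.mem_Icc,
      Finset.mem_singleton]
    grind
end

section
/- Let n, k, s be positive integers with n ≥ s + 1 + k, and let F be a family of k-element subsets of [n] with |F| ≥ C(n,k) − C(n−s,k). Suppose τ is a nonnegative real number such that |F(∅)| ≤ τ·|F({s+1})|. Then (τ+1)·|F({s+1})| + Σ_{j=1}^{s} |F({j})| ≥ s·C(n−s−1, k−1). -/
open Finset

lemma card_link (s : ℕ) (F : Finset (Finset ℕ)) (j : ℕ) :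
    (link s F j).card = (F.filter fun A => A ∩ Finset.Icc 1 (s + 1) = {j}).card := by
  refine card_image_of_injOn fun A hA B hB h => ?_
  have mem_of_inter : ∀ {C : Finset ℕ}, C ∩ Finset.Icc 1 (s + 1) = {j} → j ∈ C := fun {C} hC =>
    (mem_inter.1 (hC ▸ mem_singleton_self j : j ∈ C ∩ Finset.Icc 1 (s + 1))).1
  have hA' := mem_of_inter (mem_filter.1 hA).2
  have hB' := mem_of_inter (mem_filter.1 hB).2
  rw [← insert_erase hA', ← insert_erase hB']
  exact congrArg (insert j) h

/-- The members of `F` meeting `[s+1]` in at most one point are counted by `F(∅)` and the links. -/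
lemma card_filter_inter_card_le_one (s : ℕ) (F : Finset (Finset ℕ)) :
    (F.filter fun A => (A ∩ Finset.Icc 1 (s + 1)).card ≤ 1).card =
      (emptyPart s F).card + ∑ j ∈ Finset.Icc 1 (s + 1), (link s F j).card := by
  have hunion : (F.filter fun A => (A ∩ Finset.Icc 1 (s + 1)).card ≤ 1) =
      emptyPart s F ∪ (Finset.Icc 1 (s + 1)).biUnion
        fun j => F.filter fun A => A ∩ Finset.Icc 1 (s + 1) = {j} := by
    ext A
    simp only [emptyPart, mem_filter, mem_union, mem_biUnion]
    constructor
    · rintro ⟨hA, hcard⟩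
      rcases Nat.le_one_iff_eq_zero_or_eq_one.1 hcard with h | h
      · exact Or.inl ⟨hA, card_eq_zero.1 h⟩
      · obtain ⟨j, hj⟩ := card_eq_one.1 h
        have hmem : j ∈ A ∩ Finset.Icc 1 (s + 1) := hj ▸ mem_singleton_self j
        exact Or.inr ⟨j, (mem_inter.1 hmem).2, hA, hj⟩
    · rintro (⟨hA, h⟩ | ⟨j, -, hA, h⟩) <;> exact ⟨hA, by simp [h]⟩
  rw [hunion, card_union_of_disjoint, card_biUnion]
  · simp only [card_link]
  · intro i _ j _ hij
    refine disjoint_left.2 fun A hi hj => hij ?_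
    exact singleton_injective ((mem_filter.1 hi).2.symm.trans (mem_filter.1 hj).2)
  · refine disjoint_left.2 fun A h0 h1 => ?_
    obtain ⟨j, -, hj⟩ := mem_biUnion.1 h1
    exact singleton_ne_empty j ((mem_filter.1 hj).2.symm.trans (mem_filter.1 h0).2)

lemma choose_le_card_emptyPart_powersetCard (n k s : ℕ) :
    (n - s - 1).choose k ≤ (emptyPart s ((Finset.Icc 1 n).powersetCard k)).card := by
  have hcard : (Finset.Icc (s + 2) n).card = n - s - 1 := by rw [Nat.card_Icc]; omega
  rw [← hcard, ← card_powersetCard]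
  refine card_le_card fun A hA => ?_
  obtain ⟨hsub, hk⟩ := mem_powersetCard.1 hA
  refine mem_filter.2 ⟨mem_powersetCard.2 ⟨hsub.trans (Icc_subset_Icc_left (by omega)), hk⟩, ?_⟩
  refine eq_empty_of_forall_notMem fun x hx => ?_
  have h1 := mem_Icc.1 (hsub (mem_inter.1 hx).1)
  have h2 := mem_Icc.1 (mem_inter.1 hx).2
  omega

lemma choose_le_card_link_powersetCard {n k s j : ℕ} (hk : 0 < k) (hn : s + 1 ≤ n)
    (hj : j ∈ Finset.Icc 1 (s + 1)) :
    (n - s - 1).choose (k - 1) ≤ (link s ((Finset.Icc 1 n).powersetCard k) j).card := by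
  have hcard : (Finset.Icc (s + 2) n).card = n - s - 1 := by rw [Nat.card_Icc]; omega
  rw [← hcard, ← card_powersetCard]
  refine card_le_card fun B hB => ?_
  obtain ⟨hsub, hBk⟩ := mem_powersetCard.1 hB
  have hj' := mem_Icc.1 hj
  have hjB : j ∉ B := fun h => by
    have := mem_Icc.1 (hsub h)
    omega
  refine mem_image.2 ⟨insert j B, mem_filter.2 ⟨mem_powersetCard.2 ⟨?_, ?_⟩, ?_⟩, erase_insert hjB⟩
  · exact insert_subset (mem_Icc.2 (by omega)) (hsub.trans (Icc_subset_Icc_left (by omega)))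
  · rw [card_insert_of_notMem hjB]
    omega
  · have hdisj : B ∩ Finset.Icc 1 (s + 1) = ∅ := by
      refine eq_empty_of_forall_notMem fun x hx => ?_
      have h1 := mem_Icc.1 (hsub (mem_inter.1 hx).1)
      have h2 := mem_Icc.1 (mem_inter.1 hx).2
      omega
    rw [insert_inter_of_mem hj, hdisj]
    rfl

/-- If a family `F` of `k`-subsets of `[n]` has `|F| ≥ C(n,k) − C(n−s,k)` and
`|F(∅)| ≤ τ |F({s+1})|`, then
`(τ+1)|F({s+1})| + Σ_{j=1}^{s} |F({j})| ≥ s C(n−s−1, k−1)`. -/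
theorem link_sum_lower_bound (n k s : ℕ) (hk : 0 < k) (hs : 0 < s)
    (hn : s + 1 + k ≤ n)
    (F : Finset (Finset ℕ)) (hF : F ⊆ (Finset.Icc 1 n).powersetCard k)
    (hbig : n.choose k - (n - s).choose k ≤ F.card)
    (τ : ℝ) (hτ : 0 ≤ τ)
    (hle : ((emptyPart s F).card : ℝ) ≤ τ * ((link s F (s + 1)).card : ℝ)) :
    (s : ℝ) * ((n - s - 1).choose (k - 1) : ℝ) ≤
      (τ + 1) * ((link s F (s + 1)).card : ℝ) +
      ∑ j ∈ Finset.Icc 1 s, ((link s F j).card : ℝ) := by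
  set U := (Finset.Icc 1 n).powersetCard k with hU
  have hUcard : U.card = n.choose k := by simp [hU]
  have hsdiff : (U \ F).card ≤ (n - s).choose k := by
    rw [card_sdiff_of_subset hF]
    omega
  have hsplit : (U.filter fun A => (A ∩ Finset.Icc 1 (s + 1)).card ≤ 1).card ≤
      (F.filter fun A => (A ∩ Finset.Icc 1 (s + 1)).card ≤ 1).card + (U \ F).card := by
    refine (card_le_card fun A hA => ?_).trans (card_union_le _ _)
    obtain ⟨hAU, hA1⟩ := mem_filter.1 hA
    by_cases hAF : A ∈ F
    · exact mem_union_left _ (mem_filter.2 ⟨hAF, hA1⟩)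
    · exact mem_union_right _ (mem_sdiff.2 ⟨hAU, hAF⟩)
  rw [card_filter_inter_card_le_one, card_filter_inter_card_le_one] at hsplit
  have hempty : (n - s - 1).choose k ≤ (emptyPart s U).card :=
    choose_le_card_emptyPart_powersetCard n k s
  have hlinks : (s + 1) * (n - s - 1).choose (k - 1) ≤
      ∑ j ∈ Finset.Icc 1 (s + 1), (link s U j).card := by
    simpa using card_nsmul_le_sum (Finset.Icc 1 (s + 1)) _ _ fun j hj =>
      choose_le_card_link_powersetCard (n := n) hk (by omega) hj
  have hpascal : (n - s).choose k = (n - s - 1).choose (k - 1) + (n - s - 1).choose k :=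
    Nat.choose_eq_choose_pred_add (by omega) hk
  rw [sum_Icc_succ_top (by omega) fun j => (link s F j).card] at hsplit
  have hmain : s * (n - s - 1).choose (k - 1) ≤
      (emptyPart s F).card + (∑ j ∈ Finset.Icc 1 s, (link s F j).card +
        (link s F (s + 1)).card) := by
    rw [add_one_mul] at hlinks
    omega
  have hreal : (s : ℝ) * ((n - s - 1).choose (k - 1) : ℝ) ≤
      (emptyPart s F).card + (∑ j ∈ Finset.Icc 1 s, ((link s F j).card : ℝ) +
        (link s F (s + 1)).card) := by
    exact_mod_cast hmain
  linarith
end
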